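/- Let c be the 4-coloring of E(Q_n) given by c(xy) = (k mod 2, w(p(xy)) mod 2) for an edge xy with lower endpoint of weight k and common prefix p(xy). Then Q_n contains no induced monochromatic cycle of length 4, 6, or 10 under c. -/

import Mathlib

/-- Hamming weight of a binary string. -/
def wt {n : ℕ} (x : Fin n → Bool) : ℕ := (Finset.univ.filter fun i => x i = true).card

/-- `x` and `y` differ exactly at the coordinate `j`. -/
def diffAt {n : ℕ} (x y : Fin n → Bool) (j : Fin n) : Prop :=
  x j ≠ y j ∧ ∀ i, i ≠ j → x i = y i

/-- Weight of the prefix of `x` strictly before position `j`. -/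
def prefWt {n : ℕ} (x : Fin n → Bool) (j : Fin n) : ℕ :=
  (Finset.univ.filter fun i => i < j ∧ x i = true).card

/-- The 4-coloring `c`: for an edge `xy` differing at position `j`, with lower
endpoint of weight `k` and common prefix `p`, the color is `(k mod 2, w(p) mod 2)`. -/
def edgeColor {n : ℕ} (x y : Fin n → Bool) (j : Fin n) : ℕ × ℕ :=
  if wt x ≤ wt y then (wt x % 2, prefWt x j % 2) else (wt y % 2, prefWt y j % 2)

lemma diffAt.symm {n : ℕ} {x y : Fin n → Bool} {j : Fin n} (h : diffAt x y j) : diffAt y x j :=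
  ⟨h.1.symm, fun i hi => (h.2 i hi).symm⟩

lemma diffAt.apply_eq_not {n : ℕ} {x y : Fin n → Bool} {j : Fin n} (h : diffAt x y j) :
    y j = !x j := by
  have := h.1
  cases hx : x j <;> cases hy : y j <;> simp_all

lemma diffAt.hammingDist_eq_one {n : ℕ} {x y : Fin n → Bool} {j : Fin n} (h : diffAt x y j) :
    hammingDist x y = 1 := by
  unfold hammingDist
  rw [Finset.card_eq_one]
  refine ⟨j, ?_⟩
  ext i
  simp only [Finset.mem_filter, Finset.mem_univ, true_and, Finset.mem_singleton]
  refine ⟨fun hi => ?_, fun hi => hi ▸ h.1⟩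
  by_contra hij
  exact hi (h.2 i hij)

lemma diffAt.card_filter {n : ℕ} {x y : Fin n → Bool} {j : Fin n} (h : diffAt x y j)
    (hx : x j = false) (P : Fin n → Prop) [DecidablePred P] :
    (Finset.univ.filter fun i => P i ∧ y i = true).card =
      (Finset.univ.filter fun i => P i ∧ x i = true).card + if P j then 1 else 0 := by
  have hy : y j = true := by rw [h.apply_eq_not, hx]; rfl
  split_ifs with hP
  · rw [← Finset.card_insert_of_notMem (a := j) (by simp [hx])]
    congr 1
    ext i
    by_cases hi : i = j
    · subst hi; simp [hP, hy]
    · simp [hi, h.2 i hi]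
  · rw [add_zero]
    congr 1
    ext i
    by_cases hi : i = j
    · subst hi; simp [hP]
    · simp [h.2 i hi]

lemma diffAt.wt_eq {n : ℕ} {x y : Fin n → Bool} {j : Fin n} (h : diffAt x y j)
    (hx : x j = false) : wt y = wt x + 1 := by
  simpa [wt] using h.card_filter hx fun _ => True

lemma diffAt.prefWt_eq {n : ℕ} {x y : Fin n → Bool} {j : Fin n} (h : diffAt x y j)
    (hx : x j = false) (a : Fin n) : prefWt y a = prefWt x a + if j < a then 1 else 0 :=
  h.card_filter hx (· < a)

lemma diffAt.prefWt_mod_two {n : ℕ} {x y : Fin n → Bool} {j : Fin n} (h : diffAt x y j)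
    (a : Fin n) : prefWt y a % 2 = (prefWt x a + if j < a then 1 else 0) % 2 := by
  cases hx : x j
  · rw [h.prefWt_eq hx]
  · rw [h.symm.prefWt_eq (by rw [h.apply_eq_not, hx]; rfl) a]
    split_ifs <;> omega

lemma diffAt.edgeColor_eq {n : ℕ} {x y : Fin n → Bool} {j : Fin n} (h : diffAt x y j) :
    edgeColor x y j = ((wt x + if x j then 1 else 0) % 2, prefWt x j % 2) := by
  have hp := h.prefWt_mod_two j
  simp only [lt_irrefl, if_false, add_zero] at hp
  cases hx : x j
  · have := h.wt_eq hx
    simp [edgeColor, this]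
  · have := h.symm.wt_eq (by rw [h.apply_eq_not, hx]; rfl)
    simp only [edgeColor, this, hp]
    rw [if_neg (by omega)]
    ext <;> simp
    omega

/-- Along a monochromatic walk, steps up and steps down alternate. -/
lemma flip_alternates {n : ℕ} {x y z : Fin n → Bool} {i j : Fin n} (hxy : diffAt x y i)
    (hyz : diffAt y z j) (hc : edgeColor y z j = edgeColor x y i) : y j = !x i := by
  rw [hxy.edgeColor_eq, hyz.edgeColor_eq, Prod.mk.injEq] at hc
  have h := hc.1
  cases hx : x i
  · have := hxy.wt_eq hx
    cases hy : y j
    · simp [hx, hy] at h; omega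
    · rfl
  · have := hxy.symm.wt_eq (by rw [hxy.apply_eq_not, hx]; rfl)
    cases hy : y j
    · rfl
    · simp [hx, hy] at h; omega

/-- The list `[J (t - 1), …, J 0]` of the first `t` directions, latest first. -/
def history (J : ℕ → ℕ) : ℕ → List ℕ
  | 0 => []
  | t + 1 => J t :: history J t

lemma history_getElem? (J : ℕ → ℕ) (t i : ℕ) :
    (history J t)[i]? = if i < t then some (J (t - 1 - i)) else none := by
  induction t generalizing i with
  | zero => simp [history]
  | succ t ih =>
    cases i with
    | zero => simp [history]
    | succ i =>
      simp only [history, List.getElem?_cons_succ, ih, Nat.add_lt_add_iff_right]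
      congr 3
      omega

/-- Scanning the directions backwards, at every occurrence of `a` the numbers of scanned
directions different from `a` and smaller than `a` are both even. The Boolean arguments hold
the current parities. -/
def parityCheck (a : ℕ) : Bool → Bool → List ℕ → Bool
  | _, _, [] => true
  | e, s, b :: l =>
    if b = a then !e && !s && parityCheck a e s l
    else parityCheck a (!e) (xor s (decide (b < a))) l

/-- Necessary conditions for `a` to follow the directions `l` (latest first) in the periodic
direction sequence of an induced monochromatic cycle of length `L`. -/
def admissible (L a : ℕ) (l : List ℕ) : Bool :=
  l[0]? != some a && parityCheck a false false l &&
    !(L == 10 && l[2]? == some a && l[3]?.isSome && l[3]? == l[0]?) &&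
    (l[L - 1]?).all (· == a)

/-- Whether `l` extends by `k` admissible directions smaller than `m`. -/
def extendable (L m : ℕ) : ℕ → List ℕ → Bool
  | 0, _ => true
  | k + 1, l => (List.range m).any fun a => admissible L a l && extendable L m k (a :: l)

lemma extendable_history {L m : ℕ} {J : ℕ → ℕ} (hm : ∀ t, J t < m)
    (h : ∀ t, admissible L (J t) (history J t) = true) (k t : ℕ) :
    extendable L m k (history J t) = true := by
  induction k generalizing t with
  | zero => rfl
  | succ k ih =>
    simp only [extendable, List.any_eq_true, List.mem_range, Bool.and_eq_true]
    exact ⟨J t, hm t, h t, ih (t + 1)⟩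

lemma not_extendable {L : ℕ} (hL : L = 4 ∨ L = 6 ∨ L = 10) :
    extendable L (L / 2) 14 [] = false := by
  rcases hL with rfl | rfl | rfl <;> rfl

lemma parityCheck_history {n : ℕ} {w : ℕ → Fin n → Bool} {J : ℕ → Fin n} {r : Fin n → ℕ}
    (hd : ∀ t, diffAt (w t) (w (t + 1)) (J t))
    (hr : ∀ s t, r (J s) < r (J t) ↔ J s < J t)
    (hu : ∀ t, w (t + 1) (J (t + 1)) = !w t (J t)) {S : ℕ}
    (hS : ∀ t, prefWt (w t) (J t) % 2 = S) (k t : ℕ) (e s : Bool)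
    (he : e = xor (w t (J k)) (w t (J t)))
    (hs : s = decide (prefWt (w t) (J k) % 2 ≠ S)) :
    parityCheck (r (J k)) e s (history (fun t => r (J t)) t) = true := by
  induction t generalizing e s with
  | zero => rfl
  | succ t ih =>
    have hp := (hd t).prefWt_mod_two (J k)
    have hut := hu t
    by_cases hjk : J t = J k
    · have h1 : e = false := by
        rw [he, hut, ← hjk, (hd t).apply_eq_not]; simp
      have h2 : s = false := by
        rw [hs, hp, ← hjk]; simp [hS]
      rw [history, parityCheck, if_pos (by rw [hjk]), h1, h2]
      simp only [Bool.not_false, Bool.true_and]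
      apply ih
      · simp [hjk]
      · rw [← hjk]; simp [hS]
    · have hne : r (J t) ≠ r (J k) := by
        have h1 := hr t k
        have h2 := hr k t
        rcases lt_or_gt_of_ne hjk with h | h
        · exact (h1.2 h).ne
        · exact (h2.2 h).ne'
      rw [history, parityCheck, if_neg hne]
      apply ih
      · rw [he, hut, (hd t).2 _ (Ne.symm hjk)]
        cases w (t + 1) (J k) <;> cases w t (J t) <;> rfl
      · have hS2 : S < 2 := by rw [← hS 0]; omega
        rw [hs, hp]
        by_cases hlt : J t < J k
        · simp only [hlt, (hr t k).2 hlt, if_true, decide_true, Bool.xor_true]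
          rw [← decide_not, decide_eq_decide]
          omega
        · simp [hlt, (hr t k).not.2 hlt]

/-- The number of distinct directions is at most half the length of the cycle. -/
lemma card_image_direction_le {n L : ℕ} [NeZero L] {v : ZMod L → Fin n → Bool}
    {j : ZMod L → Fin n} (hd : ∀ i, diffAt (v i) (v (i + 1)) (j i)) :
    (Finset.univ.image j).card ≤ L / 2 := by
  have key : ∀ i, ∃ k, k ≠ i ∧ j k = j i := by
    intro i
    by_contra! hcon
    have hconst : ∀ d : ℕ, d < L → v (i + 1 + d) (j i) = v (i + 1) (j i) := by
      intro d
      induction d with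
      | zero => simp
      | succ d ih =>
        intro hlt
        rw [← ih (by omega), Nat.cast_add, Nat.cast_one, ← add_assoc]
        refine ((hd _).2 _ (hcon _ fun h => ?_).symm).symm
        have h0 : ((d + 1 : ℕ) : ZMod L) = 0 := by
          push_cast
          linear_combination h
        rw [ZMod.natCast_eq_zero_iff] at h0
        exact absurd (Nat.le_of_dvd (by omega) h0) (by omega)
    have hL : 0 < L := Nat.pos_of_neZero L
    have h := hconst (L - 1) (by omega)
    have hi : i + 1 + ((L - 1 : ℕ) : ZMod L) = i := by
      rw [Nat.cast_sub hL]
      simp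
    rw [hi] at h
    exact (hd i).1 h
  rw [Nat.le_div_iff_mul_le two_pos, mul_comm]
  have := Finset.mul_card_image_le_card (s := Finset.univ) (f := j) 2 (by
    intro a ha
    obtain ⟨i, -, rfl⟩ := Finset.mem_image.1 ha
    obtain ⟨k, hk, hjk⟩ := key i
    exact Finset.one_lt_card.2 ⟨k, by simp [hjk], i, by simp, hk⟩)
  simpa [ZMod.card] using this

/-- If the directions `a, b, c, a, b` are followed, the endpoints differ only at `c`. -/
lemma diffAt_of_repeated {n : ℕ} {w : ℕ → Fin n → Bool} {J : ℕ → Fin n}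
    (hd : ∀ t, diffAt (w t) (w (t + 1)) (J t)) {t : ℕ} (h0 : J (t + 3) = J t)
    (h1 : J (t + 4) = J (t + 1)) : diffAt (w t) (w (t + 5)) (J (t + 2)) := by
  have flip : ∀ s i, w (s + 1) i = xor (w s i) (decide (i = J s)) := by
    intro s i
    by_cases hi : i = J s
    · rw [hi, (hd s).apply_eq_not]; simp
    · rw [← (hd s).2 i hi]; simp [hi]
  have h5 : ∀ i, w (t + 5) i = xor (w t i) (decide (i = J (t + 2))) := by
    intro i
    rw [flip (t + 4), flip (t + 3), flip (t + 2), flip (t + 1), flip t, h0, h1]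
    cases w t i <;> cases decide (i = J t) <;> cases decide (i = J (t + 1)) <;>
      cases decide (i = J (t + 2)) <;> rfl
  refine ⟨?_, fun i hi => ?_⟩
  · rw [h5]; simp
  · rw [h5]; simp [hi]

/-- Under the coloring `c`, `Q_n` contains no monochromatic cycle of length
4, 6 or 10 that is induced (chordless) in `Q_n`. -/
theorem stmt3 (n L : ℕ) (hL : L = 4 ∨ L = 6 ∨ L = 10) :
    ¬ ∃ (v : ZMod L → (Fin n → Bool)) (j : ZMod L → Fin n),
      Function.Injective v ∧
      (∀ i, diffAt (v i) (v (i + 1)) (j i)) ∧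
      (∀ i k : ZMod L, k ≠ i → k ≠ i + 1 → i ≠ k + 1 → hammingDist (v i) (v k) ≠ 1) ∧
      (∀ i : ZMod L, edgeColor (v i) (v (i + 1)) (j i) = edgeColor (v 0) (v 1) (j 0)) := by
  rintro ⟨v, j, hinj, hd, hind, hcol⟩
  have hLpos : 4 ≤ L := by omega
  have : NeZero L := ⟨by omega⟩
  set w : ℕ → Fin n → Bool := fun t => v t with hw
  set J : ℕ → Fin n := fun t => j t with hJ
  have hdw : ∀ t, diffAt (w t) (w (t + 1)) (J t) := by
    intro t
    simpa [hw, hJ] using hd t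
  have hcw : ∀ t, edgeColor (w t) (w (t + 1)) (J t) = edgeColor (v 0) (v 1) (j 0) := by
    intro t
    simpa [hw, hJ] using hcol t
  have hne : ∀ (i : ZMod L) (d : ℕ), 0 < d → d < L → i + d ≠ i := by
    intro i d h0 hdL h
    rw [add_eq_left, ZMod.natCast_eq_zero_iff] at h
    exact absurd (Nat.le_of_dvd h0 h) (by omega)
  set A := Finset.univ.image j with hA
  have hmem : ∀ t, J t ∈ A := fun t => Finset.mem_image_of_mem _ (Finset.mem_univ _)
  set r : Fin n → ℕ := fun a => (A.filter (· < a)).card with hrdef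
  have hmono : ∀ s t, J s < J t → r (J s) < r (J t) := by
    intro s t hst
    apply Finset.card_lt_card
    rw [Finset.ssubset_iff_of_subset]
    · exact ⟨J s, by simp [hmem, hst], by simp⟩
    · intro a ha
      simp only [Finset.mem_filter] at ha ⊢
      exact ⟨ha.1, ha.2.trans hst⟩
  have hr : ∀ s t, r (J s) < r (J t) ↔ J s < J t := by
    intro s t
    refine ⟨fun h => ?_, hmono s t⟩
    rcases lt_trichotomy (J s) (J t) with h' | h' | h'
    · exact h'
    · rw [h'] at h; exact absurd h (lt_irrefl _)
    · exact absurd (hmono t s h') (by omega)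
  have hreq : ∀ s t, r (J s) = r (J t) → J s = J t := by
    intro s t h
    rcases lt_trichotomy (J s) (J t) with h' | h' | h'
    · exact absurd (hmono s t h') (by omega)
    · exact h'
    · exact absurd (hmono t s h') (by omega)
  have hbound : ∀ t, r (J t) < L / 2 := by
    intro t
    refine lt_of_lt_of_le (Finset.card_lt_card ?_) (card_image_direction_le hd)
    rw [Finset.ssubset_iff_of_subset (Finset.filter_subset _ _)]
    exact ⟨J t, hmem t, by simp⟩
  have hu : ∀ t, w (t + 1) (J (t + 1)) = !w t (J t) := fun t =>
    flip_alternates (hdw t) (hdw (t + 1)) (by rw [hcw, hcw])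
  have hS : ∀ t, prefWt (w t) (J t) % 2 = (edgeColor (v 0) (v 1) (j 0)).2 := by
    intro t
    rw [← hcw t, (hdw t).edgeColor_eq]
  have hadj : ∀ t, J (t + 1) ≠ J t := by
    intro t h
    have h2 : w (t + 2) = w t := by
      funext i
      by_cases hi : i = J t
      · have e1 := (hdw (t + 1)).apply_eq_not
        rw [h, (hdw t).apply_eq_not] at e1
        rw [hi]
        simpa using e1
      · rw [(hdw t).2 i hi, (hdw (t + 1)).2 i (by rwa [h])]
    have h3 := hinj h2
    rw [Nat.cast_add] at h3
    exact hne t 2 two_pos (by omega) h3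
  have hchord : L = 10 → ∀ t, ¬ (J (t + 3) = J t ∧ J (t + 4) = J (t + 1)) := by
    rintro rfl t ⟨h0, h1⟩
    have h := (diffAt_of_repeated hdw h0 h1).hammingDist_eq_one
    refine hind t (t + 5 : ℕ) ?_ ?_ ?_ h
    · rw [Nat.cast_add]; exact hne t 5 (by omega) (by omega)
    · intro h
      apply hne (t + 1) 4 (by omega) (by omega)
      push_cast at h ⊢
      linear_combination h
    · intro h
      apply hne t 6 (by omega) (by omega)
      push_cast at h ⊢
      linear_combination -h
  have hadm : ∀ t, admissible L (r (J t)) (history (fun t => r (J t)) t) = true := by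
    intro t
    simp only [admissible, Bool.and_eq_true]
    refine ⟨⟨⟨?_, ?_⟩, ?_⟩, ?_⟩
    · rw [history_getElem?, bne_iff_ne]
      cases t with
      | zero => simp
      | succ t => simpa using fun h => hadj t (hreq _ _ h).symm
    · exact parityCheck_history hdw hr hu hS t t _ _ (by simp) (by simp [hS])
    · simp only [history_getElem?, Bool.not_eq_true', Bool.eq_false_iff, ne_eq,
        Bool.and_eq_true, beq_iff_eq]
      rintro ⟨⟨⟨hL10, h2⟩, h3⟩, h4⟩
      have ht : 3 < t := by
        by_contra hcon
        simp [hcon] at h3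
      obtain ⟨s, rfl⟩ := Nat.exists_eq_add_of_lt ht
      have e1 : 3 + s + 1 - 1 - 2 = s + 1 := by omega
      have e2 : 3 + s + 1 - 1 - 3 = s := by omega
      have e3 : 3 + s + 1 - 1 - 0 = s + 3 := by omega
      have e4 : 3 + s + 1 = s + 4 := by omega
      rw [if_pos (by omega), e1, Option.some.injEq, e4] at h2
      rw [if_pos (by omega), if_pos (by omega), e2, e3, Option.some.injEq] at h4
      exact hchord hL10 s ⟨(hreq _ _ h4).symm, (hreq _ _ h2).symm⟩
    · rw [history_getElem?]
      split_ifs with h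
      · have : J (t - 1 - (L - 1)) = J t := by
          obtain ⟨s, rfl⟩ := Nat.exists_eq_add_of_le (show L ≤ t by omega)
          have e : L + s - 1 - (L - 1) = s := by omega
          simp [hJ, e]
        simp [this]
      · rfl
  have h := extendable_history hbound hadm 14 0
  rw [history, not_extendable hL] at h
  exact Bool.false_ne_true h
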